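/- arXiv:1407.4091 — 5 statements merged into one kernel-verified Lean document; each statement's English description precedes it below -/
import Mathlib

section
/- Let $V = \{v_1, \dots, v_n\}$ be a configuration of non-zero vectors in $\mathbb{R}^{d+1}$ whose linear span is all of $\mathbb{R}^{d+1}$, and let $\gamma \colon V \to \mathbb{R}^{d+1}$ be an orientation reversing function. Then there exists a point $x$ on the unit sphere $\mathbb{S}^d \subset \mathbb{R}^{d+1}$ such that $\mathrm{sgn}\langle x, v_i \rangle = -\mathrm{sgn}\langle x, \gamma(v_i) \rangle$ for every $i = 1, \dots, n$. -/
open Set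

section DeterminantIntegral

open MeasureTheory Polynomial

variable {E : Type*} [NormedAddCommGroup E] [NormedSpace ℝ E] [FiniteDimensional ℝ E]

theorem ContinuousLinearMap.det_id_add_pos_of_norm_lt_one (T : E →L[ℝ] E) (hT : ‖T‖ < 1) :
    0 < (ContinuousLinearMap.id ℝ E + T).det := by
  have hne : ∀ r ∈ Icc (0 : ℝ) 1, (ContinuousLinearMap.id ℝ E + r • T).det ≠ 0 := by
    intro r hr h0
    obtain ⟨x, hx, hx0⟩ := (Submodule.ne_bot_iff _).1 (LinearMap.bot_lt_ker_of_det_eq_zero h0).ne'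
    have hx' : x + r • T x = 0 := by simpa using hx
    have h1 : ‖x‖ = r * ‖T x‖ := by
      rw [← Real.norm_of_nonneg hr.1, ← norm_smul, ← norm_neg (r • T x),
        ← eq_neg_of_add_eq_zero_left hx']
    have h2 := T.le_opNorm x
    have h3 : 0 < ‖x‖ := norm_pos_iff.2 hx0
    nlinarith [hr.1, hr.2, norm_nonneg (T x)]
  have hcont : ContinuousOn (fun r : ℝ => (ContinuousLinearMap.id ℝ E + r • T).det) (Icc 0 1) :=
    (ContinuousLinearMap.continuous_det.comp (by fun_prop)).continuousOn
  by_contra hneg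
  have h0 : (0 : ℝ) ∈ Icc (ContinuousLinearMap.id ℝ E + (1 : ℝ) • T).det
      (ContinuousLinearMap.id ℝ E + (0 : ℝ) • T).det := by
    constructor
    · simpa using hneg
    · simp [ContinuousLinearMap.det]
  obtain ⟨r, hr, h⟩ := intermediate_value_Icc' zero_le_one hcont h0
  exact hne r hr h

theorem LipschitzWith.bijective_id_add {g : E → E} {C : NNReal} (hg : LipschitzWith C g)
    (hC : C < 1) : Function.Bijective fun x => x + g x := by
  have happ : ApproximatesLinearOn (fun x => x + g x)
      ((ContinuousLinearEquiv.refl ℝ E : E ≃L[ℝ] E) : E →L[ℝ] E) univ C := by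
    rw [ApproximatesLinearOn.approximatesLinearOn_iff_lipschitzOnWith, lipschitzOnWith_univ]
    convert hg using 1
    ext x
    simp
  have hsmall : Subsingleton E ∨
      C < ‖((ContinuousLinearEquiv.refl ℝ E).symm : E →L[ℝ] E)‖₊⁻¹ := by
    rcases subsingleton_or_nontrivial E with h | h
    · exact Or.inl h
    · right
      have : ‖((ContinuousLinearEquiv.refl ℝ E).symm : E →L[ℝ] E)‖₊ = 1 := by
        ext
        simp
      simpa [this] using hC
  exact ⟨injOn_univ.1 (happ.injOn hsmall), happ.surjective hsmall⟩

variable [MeasurableSpace E] [BorelSpace E] (μ : Measure E) [μ.IsAddHaarMeasure]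

theorem setIntegral_det_id_add_fderiv {g : E → E} {C : NNReal} {K : Set E}
    (hd : Differentiable ℝ g) (hg : LipschitzWith C g) (hC : C < 1) (hK : MeasurableSet K)
    (hsupp : ∀ x, x ∉ K → g x = 0) :
    ∫ x in K, (ContinuousLinearMap.id ℝ E + fderiv ℝ g x).det ∂μ = μ.real K := by
  have hbij := hg.bijective_id_add hC
  have himage : (fun x => x + g x) '' K = K := by
    have h : (fun x => x + g x) '' Kᶜ = Kᶜ := by
      rw [image_congr (g := id) fun x hx => by simp [hsupp x hx], image_id]
    rw [image_compl_eq hbij] at h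
    exact compl_injective h
  have h := integral_image_eq_integral_abs_det_fderiv_smul μ (s := K) (f := fun x => x + g x)
    (f' := fun x => ContinuousLinearMap.id ℝ E + fderiv ℝ g x) hK
    (fun x _ => ((hasFDerivAt_id x).add (hd x).hasFDerivAt).hasFDerivWithinAt)
    hbij.injective.injOn (fun _ => (1 : ℝ))
  rw [himage] at h
  simp only [smul_eq_mul, mul_one, integral_const, measureReal_restrict_apply_univ] at h
  rw [h]
  congr 1 with x
  refine (abs_of_pos (ContinuousLinearMap.det_id_add_pos_of_norm_lt_one _ ?_)).symm
  exact (norm_fderiv_le_of_lipschitz ℝ hg).trans_lt (by exact_mod_cast hC)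

/-- The Jacobian determinant of a compactly supported `C¹` vector field integrates to zero. -/
theorem setIntegral_det_fderiv_eq_zero [Nontrivial E] {f : E → E} {K : Set E}
    (hf : ContDiff ℝ 1 f) (hfc : HasCompactSupport f) (hK : IsCompact K)
    (hsupp : ∀ x, x ∉ K → f x = 0) :
    ∫ x in K, (fderiv ℝ f x).det ∂μ = 0 := by
  obtain ⟨C, hC⟩ := hf.lipschitzWith_of_hasCompactSupport hfc one_ne_zero
  set k := Module.finrank ℝ E
  have hk : k ≠ 0 := Module.finrank_pos.ne'
  set node : ℕ → ℝ := fun j => C + 1 + j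
  have hinj : Set.InjOn node (Finset.range (k + 1)) := by
    intro i _ j _ hij
    simpa [node] using hij
  have hlag : ∀ q : ℝ[X], q.natDegree ≤ k → q.eval 0 = ∑ j ∈ Finset.range (k + 1),
      q.eval (node j) * (Lagrange.basis (Finset.range (k + 1)) node j).eval 0 := by
    intro q hq
    have hdeg : q.degree < (Finset.range (k + 1)).card := by
      rw [Finset.card_range]
      exact (degree_le_of_natDegree_le hq).trans_lt (by exact_mod_cast Nat.lt_succ_self k)
    conv_lhs => rw [Lagrange.eq_interpolate hinj hdeg, Lagrange.interpolate_apply]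
    simp [eval_finsetSum]
  have hdet : ∀ x, (fderiv ℝ f x).det = ∑ j ∈ Finset.range (k + 1),
      (node j • ContinuousLinearMap.id ℝ E + fderiv ℝ f x).det *
        (Lagrange.basis (Finset.range (k + 1)) node j).eval 0 := by
    intro x
    have h := hlag (-(fderiv ℝ f x : E →ₗ[ℝ] E)).charpoly (LinearMap.charpoly_natDegree _).le
    simp only [LinearMap.eval_charpoly, map_zero, sub_neg_eq_add, zero_add] at h
    exact h
  have hintegral : ∀ j, ∫ x in K, (node j • ContinuousLinearMap.id ℝ E + fderiv ℝ f x).det ∂μ =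
      (X ^ k : ℝ[X]).eval (node j) * μ.real K := by
    intro j
    have hpos : 0 < node j := by positivity
    have hlip : LipschitzWith (‖(node j)⁻¹‖₊ * C) fun x => (node j)⁻¹ • f x := by
      exact (lipschitzWith_smul (node j)⁻¹).comp hC
    have hlt : ‖(node j)⁻¹‖₊ * C < 1 := by
      rw [← NNReal.coe_lt_coe]
      push_cast
      rw [norm_inv, Real.norm_of_nonneg hpos.le, inv_mul_lt_iff₀ hpos]
      have : (0 : ℝ) ≤ j := j.cast_nonneg
      simp only [node]
      linarith
    have hd := hf.differentiable one_ne_zero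
    rw [← setIntegral_det_id_add_fderiv μ (hd.const_smul (node j)⁻¹) hlip hlt hK.measurableSet
      (fun x hx => by simp [hsupp x hx]), eval_pow, eval_X, ← integral_const_mul]
    congr 1 with x
    rw [ContinuousLinearMap.det, ContinuousLinearMap.det, ← LinearMap.det_smul]
    congr 1
    ext y
    have hfd : fderiv ℝ (fun x => (node j)⁻¹ • f x) x = (node j)⁻¹ • fderiv ℝ f x :=
      fderiv_const_smul (hd x) _
    simp [Pi.smul_def, hfd, smul_smul, hpos.ne']
  have hcont : ∀ j, Continuous fun x =>
      (node j • ContinuousLinearMap.id ℝ E + fderiv ℝ f x).det := fun j =>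
    ContinuousLinearMap.continuous_det.comp
      (continuous_const.add (hf.continuous_fderiv one_ne_zero))
  simp only [hdet]
  rw [integral_finsetSum _ fun j _ =>
    (((hcont j).continuousOn.integrableOn_compact hK).mul_const _)]
  simp only [integral_mul_const, hintegral]
  have h := hlag (X ^ k) (by simp)
  simp only [eval_pow, eval_X, zero_pow hk] at h ⊢
  conv_rhs => rw [← mul_zero (μ.real K), h, Finset.mul_sum]
  exact Finset.sum_congr rfl fun j _ => by ring

end DeterminantIntegral

section Homotopy

open MeasureTheory

theorem exists_monotone_clamp {ε : ℝ} (hε : 0 < ε) :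
    ∃ κ ω : ℝ → ℝ, Continuous ω ∧ (∀ s, HasDerivAt κ (ω s) s) ∧ (∀ s, 0 ≤ ω s) ∧
      (∀ s, ε ≤ |s| → ω s = 0) ∧ 0 < ω 0 := by
  have hω : Continuous fun u : ℝ => max 0 (ε - |u|) := by fun_prop
  refine ⟨fun s => ∫ u in (0 : ℝ)..s, max 0 (ε - |u|), fun u => max 0 (ε - |u|), hω,
    fun s => hω.integral_hasStrictDerivAt 0 s |>.hasDerivAt, fun s => le_max_left _ _,
    fun s hs => max_eq_left (by linarith), by simpa using hε⟩

variable {ι : Type*} [Fintype ι]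

theorem det_fderiv_coordwise_comp {κ ω : ℝ → ℝ} (hκ : ∀ s, HasDerivAt κ (ω s) s)
    {Ψ : (ι → ℝ) → ι → ℝ} {x : ι → ℝ} (hΨ : DifferentiableAt ℝ Ψ x) :
    (fderiv ℝ (fun y i => κ (Ψ y i)) x).det = (∏ i, ω (Ψ x i)) * (fderiv ℝ Ψ x).det := by
  classical
  set D : (ι → ℝ) →L[ℝ] ι → ℝ := LinearMap.toContinuousLinearMap
    (Matrix.toLin' (Matrix.diagonal fun i => ω (Ψ x i)))
  have h : HasFDerivAt (fun y i => κ (Ψ y i)) (D.comp (fderiv ℝ Ψ x)) x := by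
    rw [hasFDerivAt_pi']
    intro i
    have hi := (hκ (Ψ x i)).comp_hasFDerivAt x (hasFDerivAt_pi'.1 hΨ.hasFDerivAt i)
    have hD : (ContinuousLinearMap.proj (R := ℝ) (φ := fun _ => ℝ) i).comp (D.comp (fderiv ℝ Ψ x)) =
        ω (Ψ x i) • (ContinuousLinearMap.proj i).comp (fderiv ℝ Ψ x) := by
      ext y
      simp [D, Matrix.mulVec_diagonal]
    rw [hD]
    exact hi
  rw [h.fderiv, ContinuousLinearMap.det, ContinuousLinearMap.toLinearMap_comp, LinearMap.det_comp]
  simp [D, LinearMap.det_toLin']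

theorem ContDiff.coordwise_comp {κ ω : ℝ → ℝ} (hω : Continuous ω)
    (hκ : ∀ s, HasDerivAt κ (ω s) s) {Ψ : (ι → ℝ) → ι → ℝ} (hΨ : ContDiff ℝ 1 Ψ) :
    ContDiff ℝ 1 fun y i => κ (Ψ y i) := by
  have h : ContDiff ℝ 1 κ := by
    rw [contDiff_one_iff_deriv]
    refine ⟨fun s => (hκ s).differentiableAt, ?_⟩
    rwa [funext fun s => (hκ s).deriv]
  exact contDiff_pi.2 fun i => h.comp (contDiff_pi.1 hΨ i)

variable [Nonempty ι]

/-- A `C¹` map that is the identity near the origin and linear with negative determinant near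
infinity vanishes at some nonzero point. -/
theorem exists_zero_of_eq_id_of_eq_linear {A : (ι → ℝ) →L[ℝ] ι → ℝ} (hA : A.det < 0)
    {Φ : (ι → ℝ) → ι → ℝ} (hΦ : ContDiff ℝ 1 Φ) (hid : ∀ x, ‖x‖ ≤ 1 → Φ x = x)
    (hlin : ∀ x, 3 ≤ ‖x‖ → Φ x = A x) : ∃ x, x ≠ 0 ∧ Φ x = 0 := by
  by_contra! hne
  have hcompact : IsCompact (Metric.closedBall (0 : ι → ℝ) 3 \ Metric.ball 0 1) :=
    (isCompact_closedBall 0 3).diff Metric.isOpen_ball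
  obtain ⟨ε, hε, hεle⟩ := hcompact.exists_forall_le' (f := fun x => ‖Φ x‖) (a := 0)
    hΦ.continuous.norm.continuousOn (fun x hx => norm_pos_iff.2 (hne x (by
      rintro rfl
      simp at hx)))
  obtain ⟨κ, ω, hωc, hκ, hω0, hωε, hωpos⟩ := exists_monotone_clamp hε
  let χ : ContDiffBump (0 : ι → ℝ) := ⟨4, 5, by norm_num, by norm_num⟩
  have hχ : ∀ x, ‖x‖ < 4 → χ =ᶠ[nhds x] 1 := fun x hx =>
    χ.eventuallyEq_one_of_mem_ball (by simpa using hx)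
  set cut : ((ι → ℝ) → ι → ℝ) → (ι → ℝ) → ι → ℝ := fun Ψ x => χ x • fun i => κ (Ψ x i) with hcut
  have hcd : ∀ {Ψ}, ContDiff ℝ 1 Ψ → ContDiff ℝ 1 (cut Ψ) := fun hΨ =>
    χ.contDiff.smul (hΨ.coordwise_comp hωc hκ)
  have hdet : ∀ {Ψ x}, ContDiff ℝ 1 Ψ → ‖x‖ < 4 →
      (fderiv ℝ (cut Ψ) x).det = (∏ i, ω (Ψ x i)) * (fderiv ℝ Ψ x).det := by
    intro Ψ x hΨ hx
    rw [← det_fderiv_coordwise_comp hκ (hΨ.differentiable one_ne_zero x)]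
    congr 1
    refine Filter.EventuallyEq.fderiv_eq ?_
    filter_upwards [hχ x hx] with y hy
    simp [hcut, hy]
  have hintegral : ∀ {Ψ}, ContDiff ℝ 1 Ψ →
      ∫ x in Metric.closedBall 0 5, (fderiv ℝ (cut Ψ) x).det = 0 := fun hΨ =>
    setIntegral_det_fderiv_eq_zero volume (hcd hΨ) (χ.hasCompactSupport.smul_right)
      (isCompact_closedBall 0 5) fun x hx => by
        have hx5 : χ x = 0 := χ.zero_of_le_dist (not_le.1 (mt Metric.mem_closedBall.2 hx)).le
        simp [hcut, hx5]
  have hAcd : ContDiff ℝ 1 A := A.contDiff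
  have hgap : ∀ x, 0 ≤ (fderiv ℝ (cut Φ) x).det - (fderiv ℝ (cut A) x).det := by
    intro x
    rcases lt_or_ge 3 ‖x‖ with hx | hx
    · have heq : cut Φ =ᶠ[nhds x] cut A := by
        filter_upwards [continuous_norm.continuousAt.eventually (lt_mem_nhds hx)] with y hy
        simp [hcut, hlin y hy.le]
      rw [heq.fderiv_eq, sub_self]
    · have hx4 : ‖x‖ < 4 := by linarith
      rw [hdet hΦ hx4, hdet hAcd hx4, A.fderiv, sub_nonneg]
      refine (mul_nonpos_of_nonneg_of_nonpos (Finset.prod_nonneg fun i _ => hω0 _) hA.le).trans ?_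
      rcases lt_or_ge ‖x‖ 1 with hx1 | hx1
      · have heq : Φ =ᶠ[nhds x] id := by
          filter_upwards [continuous_norm.continuousAt.eventually (gt_mem_nhds hx1)] with y hy
          exact hid y hy.le
        rw [heq.fderiv_eq, fderiv_id]
        exact mul_nonneg (Finset.prod_nonneg fun i _ => hω0 _) (by simp [ContinuousLinearMap.det])
      · have hle : ε ≤ ‖Φ x‖ := hεle x ⟨by simpa using hx, by simpa using hx1⟩
        obtain ⟨i, hi⟩ : ∃ i, ε ≤ |Φ x i| := by
          by_contra! hlt
          exact hle.not_gt ((pi_norm_lt_iff hε).2 hlt)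
        rw [Finset.prod_eq_zero (Finset.mem_univ i) (hωε _ hi), zero_mul]
  have hgap0 : 0 < (fderiv ℝ (cut Φ) 0).det - (fderiv ℝ (cut A) 0).det := by
    have heq : Φ =ᶠ[nhds 0] id := by
      filter_upwards [Metric.ball_mem_nhds 0 one_pos] with y hy
      exact hid y (mem_ball_zero_iff.1 hy).le
    rw [hdet hΦ (by simp), hdet hAcd (by simp), A.fderiv, heq.fderiv_eq, fderiv_id,
      hid 0 (by simp), map_zero]
    have hprod : 0 < ∏ _i : ι, ω 0 := Finset.prod_pos fun _ _ => hωpos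
    have h1 : (ContinuousLinearMap.id ℝ (ι → ℝ)).det = 1 := by simp [ContinuousLinearMap.det]
    simp only [Pi.zero_apply, h1]
    nlinarith
  have hc : ∀ {Ψ}, ContDiff ℝ 1 Ψ → Continuous fun x => (fderiv ℝ (cut Ψ) x).det := fun hΨ =>
    ContinuousLinearMap.continuous_det.comp ((hcd hΨ).continuous_fderiv one_ne_zero)
  have hio : ∀ {Ψ}, ContDiff ℝ 1 Ψ → IntegrableOn (fun x => (fderiv ℝ (cut Ψ) x).det)
      (Metric.closedBall 0 5) := fun hΨ =>
    (hc hΨ).continuousOn.integrableOn_compact (isCompact_closedBall 0 5)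
  have hpos : 0 < ∫ x in Metric.closedBall (0 : ι → ℝ) 5,
      ((fderiv ℝ (cut Φ) x).det - (fderiv ℝ (cut A) x).det) := by
    rw [setIntegral_pos_iff_support_of_nonneg_ae (Filter.Eventually.of_forall hgap)
      ((hio hΦ).sub (hio hAcd))]
    refine lt_of_lt_of_le (IsOpen.measure_pos volume (U := Function.support (fun x =>
      (fderiv ℝ (cut Φ) x).det - (fderiv ℝ (cut A) x).det) ∩ Metric.ball 0 5)
      (((hc hΦ).sub (hc hAcd)).isOpen_support.inter Metric.isOpen_ball) ⟨0, hgap0.ne', by simp⟩)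
      (measure_mono (inter_subset_inter_right _ Metric.ball_subset_closedBall))
  rw [integral_sub (hio hΦ) (hio hAcd), hintegral hΦ, hintegral hAcd, sub_self] at hpos
  exact hpos.false

/-- A `C¹` vector field making an acute angle with a linear field of negative determinant points
in the direction opposite to the position vector somewhere. -/
theorem exists_eq_neg_smul_of_dotProduct_pos {A : (ι → ℝ) →L[ℝ] ι → ℝ} (hA : A.det < 0)
    {z : (ι → ℝ) → ι → ℝ} (hz : ContDiff ℝ 1 z) (hpos : ∀ x, x ≠ 0 → 0 < A x ⬝ᵥ z x) :
    ∃ x, x ≠ 0 ∧ ∃ t : ℝ, 0 < t ∧ z x = -(t • x) := by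
  let p : ContDiffBump (0 : ι → ℝ) := ⟨1, 2, by norm_num, by norm_num⟩
  let b : ContDiffBump (0 : ι → ℝ) := ⟨2, 3, by norm_num, by norm_num⟩
  have hp1 : ∀ x, ‖x‖ ≤ 1 → p x = 1 := fun x hx => p.one_of_mem_closedBall (by simpa using hx)
  have hp0 : ∀ x, 2 ≤ ‖x‖ → p x = 0 := fun x hx => p.zero_of_le_dist (by simpa using hx)
  have hb1 : ∀ x, ‖x‖ ≤ 2 → b x = 1 := fun x hx => b.one_of_mem_closedBall (by simpa using hx)
  have hb0 : ∀ x, 3 ≤ ‖x‖ → b x = 0 := fun x hx => b.zero_of_le_dist (by simpa using hx)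
  obtain ⟨x, hx, h0⟩ := exists_zero_of_eq_id_of_eq_linear hA
    (Φ := fun x => p x • x + (1 - p x) • (b x • z x + (1 - b x) • A x))
    ((p.contDiff.smul contDiff_id).add ((contDiff_const.sub p.contDiff).smul
      ((b.contDiff.smul hz).add ((contDiff_const.sub b.contDiff).smul A.contDiff))))
    (fun x hx => by simp [hp1 x hx])
    (fun x hx => by simp [hp0 x (by linarith), hb0 x hx])
  refine ⟨x, hx, ?_⟩
  have hzx : 0 < A x ⬝ᵥ z x := hpos x hx
  have hAA : 0 < A x ⬝ᵥ A x := by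
    refine lt_of_le_of_ne (Finset.sum_nonneg fun i _ => mul_self_nonneg _) fun h => ?_
    rw [dotProduct_self_eq_zero.1 h.symm, zero_dotProduct] at hzx
    exact hzx.false
  rcases le_total ‖x‖ 2 with h2 | h2
  · simp only [hb1 x h2, one_smul, sub_self, zero_smul, add_zero] at h0
    have hplt : p x < 1 := by
      refine lt_of_le_of_ne p.le_one fun h => hx ?_
      simpa [h] using h0
    have hp : p x ≠ 0 := by
      intro h
      have : z x = 0 := by simpa [h] using h0
      simp [this] at hzx
    have hq : 1 - p x ≠ 0 := by linarith
    refine ⟨p x / (1 - p x), div_pos (lt_of_le_of_ne p.nonneg hp.symm) (by linarith), ?_⟩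
    rw [div_eq_inv_mul, mul_smul, ← smul_neg, eq_inv_smul_iff₀ hq]
    exact eq_neg_of_add_eq_zero_right h0
  · exfalso
    have h := congrArg (A x ⬝ᵥ ·) h0
    simp only [hp0 x h2, zero_smul, sub_zero, one_smul, zero_add, dotProduct_add,
      dotProduct_smul, smul_eq_mul, dotProduct_zero] at h
    have hb : b x ≤ 1 := b.le_one
    rcases (b.nonneg (x := x)).eq_or_lt with hb0 | hb0
    · simp only [← hb0, zero_mul, sub_zero, one_mul, zero_add] at h
      exact hAA.ne' h
    · have := mul_pos hb0 hzx
      nlinarith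

end Homotopy

section SignPatterns

open Matrix SignType

theorem sign_add_eq_sign_add {p₁ p₂ q₁ q₂ : ℝ} (h₁ : sign q₁ = sign p₁) (h₂ : sign q₂ = sign p₂)
    (hp : 0 ≤ p₁ * p₂) : sign (q₁ + q₂) = sign (p₁ + p₂) := by
  rcases lt_trichotomy p₁ 0 with hp₁ | rfl | hp₁
  · have hp₂ : p₂ ≤ 0 := by nlinarith
    rw [sign_neg hp₁, sign_eq_neg_one_iff] at h₁
    rcases hp₂.lt_or_eq with hp₂ | rfl
    · rw [sign_neg hp₂, sign_eq_neg_one_iff] at h₂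
      rw [sign_neg (add_neg h₁ h₂), sign_neg (add_neg hp₁ hp₂)]
    · rw [sign_zero, sign_eq_zero_iff] at h₂
      rw [h₂, add_zero, add_zero, sign_neg h₁, sign_neg hp₁]
  · rw [sign_zero, sign_eq_zero_iff] at h₁
    rw [h₁, zero_add, zero_add, h₂]
  · have hp₂ : 0 ≤ p₂ := by nlinarith
    rw [sign_pos hp₁, sign_eq_one_iff] at h₁
    rcases hp₂.lt_or_eq with hp₂ | rfl
    · rw [sign_pos hp₂, sign_eq_one_iff] at h₂
      rw [sign_pos (add_pos h₁ h₂), sign_pos (add_pos hp₁ hp₂)]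
    · rw [sign_zero, sign_eq_zero_iff] at h₂
      rw [h₂, add_zero, add_zero, sign_pos h₁, sign_pos hp₁]

theorem exists_conformal_sub_smul {κ : Type*} [Fintype κ] {a y : κ → ℝ}
    (hpos : ∃ i, 0 < a i * y i) :
    ∃ t : ℝ, 0 < t ∧ (∀ i, 0 ≤ a i * (a i - t * y i)) ∧ ∃ i, a i ≠ 0 ∧ a i - t * y i = 0 := by
  classical
  obtain ⟨i₀, hi₀⟩ := hpos
  obtain ⟨i, hi, hmin⟩ := (Finset.univ.filter fun i => 0 < a i * y i).exists_min_image
    (fun i => a i / y i) ⟨i₀, by simpa using hi₀⟩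
  simp only [Finset.mem_filter, Finset.mem_univ, true_and] at hi hmin
  have hyi : y i ≠ 0 := right_ne_zero_of_mul hi.ne'
  have hquot : ∀ j, 0 < a j * y j → 0 < a j / y j := fun j hj => by
    have hyj : y j ≠ 0 := right_ne_zero_of_mul hj.ne'
    have h : a j / y j = a j * y j / y j ^ 2 := by field_simp
    rw [h]
    positivity
  refine ⟨a i / y i, hquot i hi, fun j => ?_, i, left_ne_zero_of_mul hi.ne', by field_simp; simp⟩
  rcases lt_or_ge 0 (a j * y j) with hj | hj
  · have hyj : y j ≠ 0 := right_ne_zero_of_mul hj.ne'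
    have h : a j * a j = a j / y j * (a j * y j) := by field_simp
    nlinarith [mul_le_mul_of_nonneg_right (hmin j hj) hj.le]
  · nlinarith [mul_nonneg (hquot i hi).le (neg_nonneg.2 hj), mul_self_nonneg (a j)]

variable {d n : ℕ} {v w : Fin n → Fin (d + 1) → ℝ}

theorem exists_basis_adapted_to_zeros (hspan : Submodule.span ℝ (range v) = ⊤)
    (x : Fin (d + 1) → ℝ) :
    ∃ s : Fin (d + 1) → Fin n, (of fun r c => v (s c) r).det ≠ 0 ∧
      ∀ u, (∀ j, x ⬝ᵥ v (s j) = 0 → u ⬝ᵥ v (s j) = 0) →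
        ∀ i, x ⬝ᵥ v i = 0 → u ⬝ᵥ v i = 0 := by
  obtain ⟨B, hBT, -, hTB, hB⟩ := exists_linearIndepOn_extension
    (linearIndepOn_empty ℝ v) (empty_subset {i | x ⬝ᵥ v i = 0})
  obtain ⟨D, -, hBD, hD, hli⟩ := exists_linearIndepOn_extension hB (subset_univ B)
  have htop : Submodule.span ℝ (range fun i : D => v i) = ⊤ := by
    rw [← image_eq_range, eq_top_iff, ← hspan, Submodule.span_le, ← image_univ]
    exact hD
  let b := Module.Basis.mk hli htop.ge
  let e := b.indexEquiv (Pi.basisFun ℝ (Fin (d + 1)))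
  refine ⟨fun c => e.symm c, ?_, fun u hu i hi => ?_⟩
  · have h : LinearIndependent ℝ (of fun r c => v (e.symm c) r).col :=
      hli.comp e.symm e.symm.injective
    exact ((isUnit_iff_isUnit_det _).1 (linearIndependent_cols_iff_isUnit.1 h)).ne_zero
  · have hle : Submodule.span ℝ (v '' B) ≤ (dotProductBilin ℝ ℝ u).ker := by
      rw [Submodule.span_le]
      rintro _ ⟨k, hk, rfl⟩
      have h := hu (e ⟨k, hBD hk⟩)
      simp only [Equiv.symm_apply_apply] at h
      exact h (hBT hk)
    exact hle (hTB ⟨i, hi, rfl⟩)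

theorem adjugate_row_dotProduct (s : Fin (d + 1) → Fin n) (j : Fin (d + 1)) (i : Fin n) :
    (of fun r c => v (s c) r).adjugate j ⬝ᵥ v i =
      (of fun r c => v (Function.update s j i c) r).det := by
  have h := congrFun (cramer_eq_adjugate_mulVec (of fun r c => v (s c) r) (v i)) j
  rw [mulVec, cramer_apply] at h
  rw [← h]
  congr 1
  ext r c
  by_cases hc : c = j <;> simp [Function.update_apply, hc]

theorem adjugate_row_dotProduct_self (s : Fin (d + 1) → Fin n) (j : Fin (d + 1)) :
    (of fun r c => v (s c) r).adjugate j ⬝ᵥ v (s j) = (of fun r c => v (s c) r).det := by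
  rw [adjugate_row_dotProduct, Function.update_eq_self]

theorem adjugate_row_dotProduct_of_ne (s : Fin (d + 1) → Fin n) {j k : Fin (d + 1)} (h : k ≠ j) :
    (of fun r c => v (s c) r).adjugate j ⬝ᵥ v (s k) = 0 := by
  rw [adjugate_row_dotProduct]
  exact det_zero_of_column_eq h fun r => by simp [h]

theorem det_mul_dotProduct (s : Fin (d + 1) → Fin n) (x y : Fin (d + 1) → ℝ) :
    (of fun r c => v (s c) r).det * x ⬝ᵥ y =
      ∑ j, x ⬝ᵥ v (s j) * (of fun r c => v (s c) r).adjugate j ⬝ᵥ y := by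
  set M : Matrix (Fin (d + 1)) (Fin (d + 1)) ℝ := of fun r c => v (s c) r
  have h : x ⬝ᵥ M *ᵥ (M.adjugate *ᵥ y) = M.det * x ⬝ᵥ y := by
    rw [mulVec_mulVec, mul_adjugate, smul_mulVec, one_mulVec, dotProduct_smul, smul_eq_mul]
  rw [← h, dotProduct_mulVec]
  rfl

/-- If the chirotopes of `v` and `w` are opposite, every covector of `v` is a covector of `w`. -/
theorem exists_dotProduct_sign_eq (hspan : Submodule.span ℝ (range v) = ⊤)
    (hrev : ∀ s : Fin (d + 1) → Fin n,
      sign (of fun r c => v (s c) r).det = -sign (of fun r c => w (s c) r).det)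
    (x : Fin (d + 1) → ℝ) : ∃ z, ∀ i, sign (z ⬝ᵥ w i) = sign (x ⬝ᵥ v i) := by
  classical
  induction hm : (Finset.univ.filter fun i => x ⬝ᵥ v i ≠ 0).card using Nat.strong_induction_on
    generalizing x with | _ m ih
  have ih' : ∀ y, (∀ i, x ⬝ᵥ v i = 0 → y ⬝ᵥ v i = 0) → (∃ i, x ⬝ᵥ v i ≠ 0 ∧ y ⬝ᵥ v i = 0) →
      ∃ z, ∀ i, sign (z ⬝ᵥ w i) = sign (y ⬝ᵥ v i) := by
    rintro y hy ⟨i, hxi, hyi⟩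
    refine ih _ ?_ y rfl
    rw [← hm]
    refine Finset.card_lt_card (Finset.ssubset_iff_of_subset ?_ |>.2 ⟨i, by simpa, by simpa⟩)
    intro k hk
    simp only [Finset.mem_filter, Finset.mem_univ, true_and] at hk ⊢
    exact mt (hy k) hk
  by_cases hx : x = 0
  · exact ⟨0, by simp [hx]⟩
  obtain ⟨s, hdet, hker⟩ := exists_basis_adapted_to_zeros hspan x
  obtain ⟨j₀, hj₀⟩ : ∃ j, x ⬝ᵥ v (s j) ≠ 0 := by
    by_contra! h
    refine hx (dotProduct_eq_zero x fun y => ?_)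
    have := det_mul_dotProduct (v := v) s x y
    simpa [h, hdet] using this
  by_cases hj : ∃ j₁, j₁ ≠ j₀ ∧ x ⬝ᵥ v (s j₁) ≠ 0
  · obtain ⟨j₁, hne, hj₁⟩ := hj
    set u := (x ⬝ᵥ v (s j₀) * (of fun r c => v (s c) r).det) •
      (of fun r c => v (s c) r).adjugate j₀ with hu
    have hu₀ : 0 < x ⬝ᵥ v (s j₀) * u ⬝ᵥ v (s j₀) := by
      rw [hu, smul_dotProduct, adjugate_row_dotProduct_self, smul_eq_mul]
      have : 0 < (x ⬝ᵥ v (s j₀) * (of fun r c => v (s c) r).det) ^ 2 := by positivity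
      linarith
    have hu₁ : ∀ j, j ≠ j₀ → u ⬝ᵥ v (s j) = 0 := fun j hj => by
      rw [hu, smul_dotProduct, adjugate_row_dotProduct_of_ne s hj, smul_zero]
    have huz : ∀ i, x ⬝ᵥ v i = 0 → u ⬝ᵥ v i = 0 := hker u fun j hj =>
      hu₁ j (by rintro rfl; exact hj₀ hj)
    obtain ⟨t, ht, hconf, i₁, hi₁, hzero₁⟩ := exists_conformal_sub_smul
      (a := fun i => x ⬝ᵥ v i) (y := fun i => u ⬝ᵥ v i) ⟨s j₀, hu₀⟩
    set y := x - t • u with hy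
    have hyv : ∀ i, y ⬝ᵥ v i = x ⬝ᵥ v i - t * u ⬝ᵥ v i := fun i => by
      rw [hy, sub_dotProduct, smul_dotProduct, smul_eq_mul]
    simp only [← hyv] at hconf hzero₁
    have hyz : ∀ i, x ⬝ᵥ v i = 0 → y ⬝ᵥ v i = 0 := fun i hi => by
      rw [hyv, hi, huz i hi, mul_zero, sub_zero]
    have hy₁ : y ⬝ᵥ v (s j₁) = x ⬝ᵥ v (s j₁) := by rw [hyv, hu₁ j₁ hne, mul_zero, sub_zero]
    obtain ⟨r, hr, hconf', i₂, hi₂, hzero₂⟩ := exists_conformal_sub_smul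
      (a := fun i => x ⬝ᵥ v i) (y := fun i => y ⬝ᵥ v i)
      ⟨s j₁, by simpa [hy₁] using hj₁⟩
    have hyv' : ∀ i, (x - r • y) ⬝ᵥ v i = x ⬝ᵥ v i - r * y ⬝ᵥ v i := fun i => by
      rw [sub_dotProduct, smul_dotProduct, smul_eq_mul]
    simp only [← hyv'] at hconf' hzero₂
    obtain ⟨z₁, hz₁⟩ := ih' y hyz ⟨i₁, hi₁, hzero₁⟩
    obtain ⟨z₂, hz₂⟩ := ih' (x - r • y) (fun i hi => by rw [hyv', hi, hyz i hi, mul_zero, sub_zero])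
      ⟨i₂, hi₂, hzero₂⟩
    refine ⟨z₁ + z₂, fun i => ?_⟩
    have hsum : x ⬝ᵥ v i = r * y ⬝ᵥ v i + (x - r • y) ⬝ᵥ v i := by rw [hyv']; ring
    rw [add_dotProduct, hsum]
    refine sign_add_eq_sign_add (by rw [hz₁, sign_mul, sign_pos hr, one_mul]) (hz₂ i) ?_
    rcases eq_or_ne (x ⬝ᵥ v i) 0 with hxi | hxi
    · rw [hyz i hxi]
      simp
    · have h := mul_nonneg hr.le (mul_nonneg (hconf i) (hconf' i))
      have hsq : 0 < (x ⬝ᵥ v i) ^ 2 := by positivity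
      refine nonneg_of_mul_nonneg_right ?_ hsq
      linarith
  · push Not at hj
    refine ⟨-(x ⬝ᵥ v (s j₀) * (of fun r c => v (s c) r).det) •
      (of fun r c => w (s c) r).adjugate j₀, fun i => ?_⟩
    have h := det_mul_dotProduct (v := v) s x (v i)
    rw [Finset.sum_eq_single j₀ (fun j _ hne => by rw [hj j hne, zero_mul]) (by simp),
      adjugate_row_dotProduct] at h
    have hs : sign ((of fun r c => v (s c) r).det * (of fun r c => v (s c) r).det) = 1 :=
      sign_pos (mul_self_pos.2 hdet)
    have hx : sign (x ⬝ᵥ v i) = sign (x ⬝ᵥ v (s j₀)) * sign (of fun r c => v (s c) r).det *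
        sign (of fun r c => v (Function.update s j₀ i c) r).det := by
      rw [← one_mul (sign (x ⬝ᵥ v i)), ← hs, ← sign_mul, mul_assoc, h, ← sign_mul, ← sign_mul]
      congr 1
      ring
    rw [hx, hrev (Function.update s j₀ i), smul_dotProduct, adjugate_row_dotProduct, smul_eq_mul,
      sign_mul, Left.sign_neg, sign_mul, neg_mul, mul_neg]

end SignPatterns

section Selection

open Matrix SignType

theorem sign_sum_eq {κ : Type*} {s : Finset κ} {f : κ → ℝ} {τ : SignType}
    (hf : ∀ k ∈ s, f k = 0 ∨ sign (f k) = τ) {k : κ} (hk : k ∈ s) (hfk : sign (f k) = τ) :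
    sign (∑ k ∈ s, f k) = τ := by
  rcases SignType.trichotomy τ with rfl | rfl | rfl
  · simp only [sign_eq_neg_one_iff] at *
    refine Finset.sum_neg' (fun l hl => ?_) ⟨k, hk, hfk⟩
    rcases hf l hl with h | h <;> exact h.le
  · simp only [sign_eq_zero_iff, or_self] at *
    exact Finset.sum_eq_zero hf
  · simp only [sign_eq_one_iff] at *
    refine Finset.sum_pos' (fun l hl => ?_) ⟨k, hk, hfk⟩
    rcases hf l hl with h | h
    exacts [h.ge, h.le]

/-- A smooth weight on `ℝ` supported on the numbers of sign `σ` if `σ ≠ 0`, and constant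
otherwise. -/
noncomputable def signWeight (σ : SignType) (a : ℝ) : ℝ :=
  if σ = 0 then 1 else expNegInvGlue (σ * a)

theorem contDiff_signWeight (σ : SignType) : ContDiff ℝ 1 (signWeight σ) := by
  unfold signWeight
  split_ifs
  · exact contDiff_const
  · exact expNegInvGlue.contDiff.comp (contDiff_const.mul contDiff_id)

theorem signWeight_nonneg (σ : SignType) (a : ℝ) : 0 ≤ signWeight σ a := by
  unfold signWeight
  split_ifs
  exacts [zero_le_one, expNegInvGlue.nonneg _]

theorem signWeight_sign_pos (a : ℝ) : 0 < signWeight (sign a) a := by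
  unfold signWeight
  split_ifs with h
  · exact one_pos
  · rw [sign_mul_self]
    exact expNegInvGlue.pos_of_pos (abs_pos.2 (sign_ne_zero.1 h))

theorem eq_zero_or_eq_sign_of_signWeight_ne_zero {σ : SignType} {a : ℝ}
    (h : signWeight σ a ≠ 0) : σ = 0 ∨ σ = sign a := by
  refine or_iff_not_imp_left.2 fun hσ => ?_
  have hpos : 0 < (σ : ℝ) * a := by
    by_contra! hle
    simp [signWeight, hσ, expNegInvGlue.zero_of_nonpos hle] at h
  rcases SignType.trichotomy σ with rfl | rfl | rfl
  · simp only [coe_neg_one, neg_mul, one_mul, Left.neg_pos_iff] at hpos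
    exact (sign_neg hpos).symm
  · exact absurd rfl hσ
  · simp only [coe_one, one_mul] at hpos
    exact (sign_pos hpos).symm

variable {m n : ℕ} {v w : Fin n → Fin m → ℝ}

/-- If every sign vector of `v` is one of `w`, the corresponding points can be chosen smoothly. -/
theorem exists_contDiff_dotProduct_sign_eq
    (h : ∀ x, ∃ z, ∀ i, sign (z ⬝ᵥ w i) = sign (x ⬝ᵥ v i)) :
    ∃ z : (Fin m → ℝ) → Fin m → ℝ, ContDiff ℝ 1 z ∧
      ∀ x i, sign (z x ⬝ᵥ w i) = sign (x ⬝ᵥ v i) := by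
  classical
  have hσ : ∀ σ : Fin n → SignType, ∃ z, (∀ i, z ⬝ᵥ w i = 0 ∨ sign (z ⬝ᵥ w i) = σ i) ∧
      ∀ x, (∀ i, sign (x ⬝ᵥ v i) = σ i) → ∀ i, sign (z ⬝ᵥ w i) = σ i := by
    intro σ
    by_cases hσ : ∃ x, ∀ i, sign (x ⬝ᵥ v i) = σ i
    · obtain ⟨x, hx⟩ := hσ
      obtain ⟨z, hz⟩ := h x
      exact ⟨z, fun i => .inr ((hz i).trans (hx i)), fun _ _ i => (hz i).trans (hx i)⟩
    · exact ⟨0, fun i => .inl (zero_dotProduct _), fun x hx => absurd ⟨x, hx⟩ hσ⟩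
  choose z hz hzσ using hσ
  refine ⟨fun x => ∑ σ, (∏ i, signWeight (σ i) (x ⬝ᵥ v i)) • z σ, ?_, fun x i => ?_⟩
  · refine ContDiff.sum fun σ _ => ContDiff.fun_smul (contDiff_prod fun i _ => ?_) contDiff_const
    refine (contDiff_signWeight _).comp ?_
    unfold dotProduct
    fun_prop
  · simp only [sum_dotProduct, smul_dotProduct, smul_eq_mul]
    have hpos : 0 < ∏ i, signWeight (sign (x ⬝ᵥ v i)) (x ⬝ᵥ v i) :=
      Finset.prod_pos fun i _ => signWeight_sign_pos _
    refine sign_sum_eq (fun σ _ => ?_) (Finset.mem_univ fun i => sign (x ⬝ᵥ v i)) ?_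
    · by_cases h0 : ∏ i, signWeight (σ i) (x ⬝ᵥ v i) = 0
      · exact .inl (by rw [h0, zero_mul])
      have hP : 0 < ∏ i, signWeight (σ i) (x ⬝ᵥ v i) :=
        lt_of_le_of_ne (Finset.prod_nonneg fun i _ => signWeight_nonneg _ _) (Ne.symm h0)
      rw [sign_mul, sign_pos hP, one_mul, mul_eq_zero, or_iff_right h0]
      rcases hz σ i with h1 | h1
      · exact .inl h1
      rcases eq_zero_or_eq_sign_of_signWeight_ne_zero
        (Finset.prod_ne_zero_iff.1 h0 i (Finset.mem_univ i)) with h2 | h2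
      · exact .inl (sign_eq_zero_iff.1 (h1.trans h2))
      · exact .inr (h1.trans h2)
    · rw [sign_mul, sign_pos hpos, one_mul, hzσ _ x fun _ => rfl]

end Selection

section OrientationReversing

open Matrix SignType

theorem Real.sign_eq_neg_sign_iff {a b : ℝ} :
    Real.sign a = -Real.sign b ↔ SignType.sign a = -SignType.sign b := by
  rcases lt_trichotomy a 0 with ha | rfl | ha <;> rcases lt_trichotomy b 0 with hb | rfl | hb <;>
    simp [Real.sign_of_neg, Real.sign_of_pos, *] <;> norm_num

variable {d n : ℕ} {v w : Fin n → Fin (d + 1) → ℝ}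

theorem sign_det_eq_neg_of_strictMono
    (hrev : ∀ s : Fin (d + 1) → Fin n, StrictMono s →
      sign (of fun r c => v (s c) r).det = -sign (of fun r c => w (s c) r).det)
    (s : Fin (d + 1) → Fin n) :
    sign (of fun r c => v (s c) r).det = -sign (of fun r c => w (s c) r).det := by
  by_cases hs : Function.Injective s
  · have h := hrev (s ∘ Tuple.sort s) ((Tuple.monotone_sort s).strictMono_of_injective
      (hs.comp (Tuple.sort s).injective))
    have hperm : ∀ u : Fin n → Fin (d + 1) → ℝ,
        (of fun r c => u ((s ∘ Tuple.sort s) c) r).det =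
          Equiv.Perm.sign (Tuple.sort s) * (of fun r c => u (s c) r).det := fun u =>
      det_permute' (Tuple.sort s) (of fun r c => u (s c) r)
    rw [hperm, hperm] at h
    rcases Int.units_eq_one_or (Equiv.Perm.sign (Tuple.sort s)) with h1 | h1 <;>
      simpa [h1, Left.sign_neg, neg_eq_iff_eq_neg] using h
  · obtain ⟨j, k, hjk, hne⟩ := Function.not_injective_iff.1 hs
    rw [det_zero_of_column_eq hne fun r => by simp [hjk],
      det_zero_of_column_eq hne fun r => by simp [hjk]]
    simp

theorem exists_ne_zero_sign_dotProduct_eq_neg (hspan : Submodule.span ℝ (range v) = ⊤)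
    (hrev : ∀ s : Fin (d + 1) → Fin n,
      sign (of fun r c => v (s c) r).det = -sign (of fun r c => w (s c) r).det) :
    ∃ x : Fin (d + 1) → ℝ, x ≠ 0 ∧ ∀ i, sign (x ⬝ᵥ v i) = -sign (x ⬝ᵥ w i) := by
  obtain ⟨z, hz, hzw⟩ :=
    exists_contDiff_dotProduct_sign_eq (exists_dotProduct_sign_eq hspan hrev)
  obtain ⟨s, hdet, -⟩ := exists_basis_adapted_to_zeros hspan 0
  set V : Matrix (Fin (d + 1)) (Fin (d + 1)) ℝ := of fun r c => v (s c) r with hV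
  set W : Matrix (Fin (d + 1)) (Fin (d + 1)) ℝ := of fun r c => w (s c) r with hW
  have hdetA : (LinearMap.toContinuousLinearMap (toLin' (W * Vᵀ))).det < 0 := by
    rw [LinearMap.det_toContinuousLinearMap, LinearMap.det_toLin', det_mul, det_transpose,
      ← sign_eq_neg_one_iff, sign_mul, ← neg_neg (sign W.det), ← hrev s, neg_mul, ← sign_mul,
      sign_pos (mul_self_pos.2 hdet)]
  have hnonneg : ∀ x i, 0 ≤ x ⬝ᵥ v i * z x ⬝ᵥ w i := fun x i => by
    rw [← sign_nonneg_iff, sign_mul, hzw, ← sign_mul, sign_nonneg_iff]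
    exact mul_self_nonneg _
  obtain ⟨x, hx, t, ht, hzx⟩ := exists_eq_neg_smul_of_dotProduct_pos hdetA hz fun x hx => by
    have hA : LinearMap.toContinuousLinearMap (toLin' (W * Vᵀ)) x ⬝ᵥ z x =
        ∑ j, x ⬝ᵥ v (s j) * z x ⬝ᵥ w (s j) := by
      rw [LinearMap.coe_toContinuousLinearMap', toLin'_apply, ← mulVec_mulVec, mulVec_transpose,
        dotProduct_comm, dotProduct_mulVec, dotProduct_comm]
      rfl
    rw [hA]
    refine Finset.sum_pos' (fun j _ => hnonneg x _) ?_
    by_contra! hle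
    refine hx (dotProduct_eq_zero x fun y => ?_)
    have hj : ∀ j, x ⬝ᵥ v (s j) = 0 := fun j => by
      have h0 : x ⬝ᵥ v (s j) * z x ⬝ᵥ w (s j) = 0 :=
        le_antisymm (hle j (Finset.mem_univ j)) (hnonneg x _)
      rw [← sign_eq_zero_iff, sign_mul, hzw, ← sign_mul, sign_eq_zero_iff] at h0
      exact mul_self_eq_zero.1 h0
    have := det_mul_dotProduct (v := v) s x y
    simpa [hj, ← hV, hdet] using this
  refine ⟨x, hx, fun i => ?_⟩
  rw [← hzw, hzx, neg_dotProduct, smul_dotProduct, Left.sign_neg, smul_eq_mul, sign_mul,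
    sign_pos ht, one_mul]

end OrientationReversing

/-- **Vector configuration reversal theorem.** Given non-zero vectors `v 1, …, v n`
spanning ℝ^{d+1} and an orientation reversing function `γ`, there is a point `x` on the
unit sphere such that `sgn ⟨x, v i⟩ = - sgn ⟨x, γ (v i)⟩` for every `i`. -/
theorem sphere_point_of_orientation_reversing {d n : ℕ}
    (v : Fin n → (Fin (d + 1) → ℝ))
    (γ : (Fin (d + 1) → ℝ) → (Fin (d + 1) → ℝ))
    (hv0 : ∀ i, v i ≠ 0)
    (hspan : Submodule.span ℝ (Set.range v) = ⊤)
    (hrev : ∀ s : Fin (d + 1) → Fin n, StrictMono s →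
      Real.sign (Matrix.of fun r c : Fin (d + 1) => v (s c) r).det =
        - Real.sign (Matrix.of fun r c : Fin (d + 1) => γ (v (s c)) r).det) :
    ∃ x : Fin (d + 1) → ℝ, (∑ j, x j ^ 2 = 1) ∧
      ∀ i, Real.sign (∑ j, x j * v i j) = - Real.sign (∑ j, x j * γ (v i) j) := by
  have hsign := sign_det_eq_neg_of_strictMono (v := v) (w := fun i => γ (v i))
    fun s hs => Real.sign_eq_neg_sign_iff.1 (hrev s hs)
  obtain ⟨x, hx, hxs⟩ := exists_ne_zero_sign_dotProduct_eq_neg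
    (w := fun i => γ (v i)) hspan hsign
  have hpos : 0 < ∑ j, x j ^ 2 := by
    obtain ⟨j, hj⟩ := Function.ne_iff.1 hx
    exact Finset.sum_pos' (fun j _ => sq_nonneg _) ⟨j, Finset.mem_univ j, sq_pos_iff.2 hj⟩
  have hr : 0 < (√(∑ j, x j ^ 2))⁻¹ := inv_pos.2 (Real.sqrt_pos.2 hpos)
  refine ⟨(√(∑ j, x j ^ 2))⁻¹ • x, ?_, fun i => Real.sign_eq_neg_sign_iff.2 ?_⟩
  · simp only [Pi.smul_apply, smul_eq_mul, mul_pow, ← Finset.mul_sum]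
    rw [inv_pow, Real.sq_sqrt hpos.le, inv_mul_cancel₀ hpos.ne']
  · change SignType.sign (_ • x ⬝ᵥ v i) = -SignType.sign (_ • x ⬝ᵥ γ (v i))
    rw [smul_dotProduct, smul_dotProduct, smul_eq_mul, smul_eq_mul, sign_mul, sign_mul,
      sign_pos hr, one_mul, one_mul, hxs]
end

section
/- Let $A_1, A_2, \dots, A_n$ and $B_1, B_2, \dots, B_n$ be the vertices of two convex polygons in the plane, listed in convex position in cyclic order with opposite orientations (the $A_j$ in counterclockwise order and the $B_j$ in clockwise order). Then there exists a line in $\mathbb{R}^2$ that intersects each of the closed segments $[A_j, B_j]$ for $j = 1, \dots, n$. -/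
open Set

/-- Determinant of the (d+1)×(d+1) matrix whose i-th column is the point `a i ∈ ℝ^d`
augmented by a final coordinate equal to 1. -/
noncomputable def liftDet {d : ℕ} (a : Fin (d + 1) → (Fin d → ℝ)) : ℝ :=
  (Matrix.of fun j i : Fin (d + 1) =>
    Fin.lastCases (1 : ℝ) (fun j' => a i j') j).det

/-- An affine hyperplane in ℝ^d, given as the zero set of a non-trivial affine functional. -/
def IsAffHyperplane {d : ℕ} (H : Set (Fin d → ℝ)) : Prop :=
  ∃ (u : Fin d → ℝ) (c : ℝ), u ≠ 0 ∧ H = {x | ∑ j, u j * x j = c}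

/-- A convex curve in ℝ^d: continuous on [0,1] and meets every affine hyperplane
in at most d parameter values. -/
def IsConvexCurve {d : ℕ} (C : ℝ → (Fin d → ℝ)) : Prop :=
  ContinuousOn C (Icc 0 1) ∧
  ∀ H : Set (Fin d → ℝ), IsAffHyperplane H →
    {t ∈ Icc (0 : ℝ) 1 | C t ∈ H}.encard ≤ (d : ℕ∞)

def PosOriented {d : ℕ} (C : ℝ → (Fin d → ℝ)) : Prop :=
  ∀ t : Fin (d + 1) → ℝ, StrictMono t → (∀ i, t i ∈ Icc (0 : ℝ) 1) →
    0 < liftDet (fun i => C (t i))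

def NegOriented {d : ℕ} (C : ℝ → (Fin d → ℝ)) : Prop :=
  ∀ t : Fin (d + 1) → ℝ, StrictMono t → (∀ i, t i ∈ Icc (0 : ℝ) 1) →
    liftDet (fun i => C (t i)) < 0

def OrderTypeReversingOn {d : ℕ} (γ : (Fin d → ℝ) → (Fin d → ℝ))
    (A : Set (Fin d → ℝ)) : Prop :=
  ∀ a : Fin (d + 1) → (Fin d → ℝ), (∀ i, a i ∈ A) → Function.Injective a →
    Real.sign (liftDet a) = - Real.sign (liftDet (γ ∘ a))

open Complex Real Topology Filter

lemma Complex.arg_div_eq_sub {x y : ℂ} (hx : x ≠ 0) (hy : y ≠ 0)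
    (h : arg x - arg y ∈ Ioc (-π) π) : arg (x / y) = arg x - arg y := by
  rw [← arg_coe_angle_toReal_eq_arg, arg_div_coe_angle hx hy, ← Real.Angle.coe_sub,
    Real.Angle.toReal_coe_eq_self_iff_mem_Ioc.2 h]

lemma Complex.arg_div_eq_sub_of_re_pos {x y u : ℂ} (hx : 0 < (x / u).re) (hy : 0 < (y / u).re) :
    arg (x / y) = arg (x / u) - arg (y / u) := by
  have hx0 : x / u ≠ 0 := fun h => by simp [h] at hx
  have hy0 : y / u ≠ 0 := fun h => by simp [h] at hy
  have hu : u ≠ 0 := fun h => by simp [h] at hx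
  have h1 := abs_lt.1 (abs_arg_lt_pi_div_two_iff.2 (Or.inl hx))
  have h2 := abs_lt.1 (abs_arg_lt_pi_div_two_iff.2 (Or.inl hy))
  rw [← arg_div_eq_sub hx0 hy0 ⟨by linarith, by linarith⟩, div_div_div_cancel_right₀ hu]

lemma Complex.arg_div_exp_eq_sub {z : ℂ} {s t : ℝ} (hs : 0 < (z / exp (s * I)).re)
    (hst : |t - s| < π / 2) :
    arg (z / exp (t * I)) = arg (z / exp (s * I)) - (t - s) := by
  have h0 : z / exp (s * I) ≠ 0 := fun h => by simp [h] at hs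
  have h1 := abs_lt.1 (abs_arg_lt_pi_div_two_iff.2 (Or.inl hs))
  have h2 := abs_lt.1 hst
  have h3 : arg (exp ((t - s : ℝ) * I)) = t - s := by
    rw [exp_mul_I, arg_cos_add_sin_mul_I ⟨by linarith [Real.pi_pos], by linarith [Real.pi_pos]⟩]
  have h4 : z / exp (t * I) = z / exp (s * I) / exp ((t - s : ℝ) * I) := by
    rw [div_div, ← exp_add]
    congr 2
    push_cast
    ring
  rw [h4, arg_div_eq_sub h0 (exp_ne_zero _) (by rw [h3]; constructor <;> linarith), h3]

/-- Twice the signed area of the triangle with vertices `a`, `b`, `c`. -/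
def signedArea (a b c : ℂ) : ℝ :=
  (b - a).re * (c - a).im - (b - a).im * (c - a).re

lemma signedArea_rotate (a b c : ℂ) : signedArea b c a = signedArea a b c := by
  simp only [signedArea, sub_re, sub_im]; ring

lemma signedArea_swap (a b c : ℂ) : signedArea a c b = -signedArea a b c := by
  simp only [signedArea, sub_re, sub_im]; ring

lemma signedArea_reverse (a b c : ℂ) : signedArea c b a = -signedArea a b c := by
  simp only [signedArea, sub_re, sub_im]; ring

lemma ne_of_signedArea_ne_zero {a b c : ℂ} (h : signedArea a b c ≠ 0) :
    a ≠ b ∧ b ≠ c ∧ c ≠ a := by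
  refine ⟨?_, ?_, ?_⟩ <;> rintro rfl <;> apply h <;>
    simp only [signedArea, sub_re, sub_im] <;> ring

lemma im_div_sub_pos {a b c : ℂ} (h : 0 < signedArea a b c) : 0 < ((c - a) / (b - a)).im := by
  have hb : 0 < normSq (b - a) :=
    normSq_pos.2 (sub_ne_zero.2 (ne_of_signedArea_ne_zero h.ne').1.symm)
  rw [div_im, ← sub_div]
  apply div_pos _ hb
  simp only [signedArea] at h
  linarith

lemma arg_mem_Ioo_of_im_pos {z : ℂ} (h : 0 < z.im) : arg z ∈ Ioo 0 π := by
  refine ⟨lt_of_le_of_ne (arg_nonneg_iff.2 h.le) fun h0 => ?_, arg_lt_pi_iff.2 (Or.inr h.ne')⟩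
  exact h.ne' (arg_eq_zero_iff.1 h0.symm).2

/-- The oriented angle at `b` from `c` to `a`. -/
noncomputable def vertexAngle (a b c : ℂ) : ℝ := arg ((a - b) / (c - b))

lemma vertexAngle_sum_of_pos {a b c : ℂ} (h : 0 < signedArea a b c) :
    vertexAngle a b c + vertexAngle b c a + vertexAngle c a b = π := by
  obtain ⟨hab, hbc, hca⟩ := ne_of_signedArea_ne_zero h.ne'
  have h1 := arg_mem_Ioo_of_im_pos (im_div_sub_pos h)
  have h2 := arg_mem_Ioo_of_im_pos (im_div_sub_pos ((signedArea_rotate a b c).symm ▸ h))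
  have h3 := arg_mem_Ioo_of_im_pos (im_div_sub_pos ((signedArea_rotate c a b) ▸ h))
  have key : ((vertexAngle a b c + vertexAngle b c a + vertexAngle c a b : ℝ) : Real.Angle) =
      (π : ℝ) := by
    have e (x y z : ℂ) (hxy : x ≠ y) (hzy : z ≠ y) :
        (vertexAngle x y z : Real.Angle) = arg (x - y) - arg (z - y) :=
      arg_div_coe_angle (sub_ne_zero.2 hxy) (sub_ne_zero.2 hzy)
    have n (x y : ℂ) (hxy : x ≠ y) : (arg (x - y) : Real.Angle) = arg (y - x) + (π : ℝ) := by
      rw [← arg_neg_coe_angle (sub_ne_zero.2 hxy.symm), neg_sub]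
    rw [Real.Angle.coe_add, Real.Angle.coe_add, e a b c hab hbc.symm, e b c a hbc hca.symm,
      e c a b hca hab.symm, n a b hab, n b c hbc, n c a hca]
    have : ((π : ℝ) : Real.Angle) + (π : ℝ) = 0 := by
      rw [← Real.Angle.coe_add, ← two_mul, Real.Angle.coe_two_pi]
    linear_combination (norm := abel) this
  obtain ⟨k, hk⟩ := Real.Angle.angle_eq_iff_two_pi_dvd_sub.1 key
  simp only [vertexAngle, mem_Ioo] at *
  have hk1 : (k : ℝ) < 2 := by nlinarith [Real.pi_pos]
  have hk2 : (-1 : ℝ) < k := by nlinarith [Real.pi_pos]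
  have : k < 2 := by exact_mod_cast hk1
  have : -1 < k := by exact_mod_cast hk2
  have : k = 0 ∨ k = 1 := by omega
  rcases this with rfl | rfl
  · simp at hk; linarith
  · push_cast at hk; linarith

lemma vertexAngle_swap {a b c : ℂ} (h : vertexAngle a b c ≠ π) :
    vertexAngle c b a = -vertexAngle a b c := by
  rw [vertexAngle, ← inv_div, arg_inv, ← vertexAngle, if_neg h]

/-- All points of the family other than `P j`, seen from `P j`, lie within an angle of less
than `π`. -/
def IsPointed {ι : Type*} (P : ι → ℂ) : Prop :=
  ∀ j, ∃ v : ℂ, v ≠ 0 ∧ ∀ i, i ≠ j → ∀ k, k ≠ j →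
    arg ((P i - P j) / v) - arg ((P k - P j) / v) ∈ Ioo (-π) π

lemma IsPointed.comp_equiv {ι κ : Type*} {P : ι → ℂ} {e : κ ≃ ι} (h : IsPointed (P ∘ e)) :
    IsPointed P := by
  intro j
  obtain ⟨v, hv, H⟩ := h (e.symm j)
  refine ⟨v, hv, fun i hi k hk => ?_⟩
  simpa using H (e.symm i) (by simpa) (e.symm k) (by simpa)

lemma isPointed_of_signedArea_pos {n : ℕ} {P : Fin n → ℂ}
    (h : ∀ i j k, i < j → j < k → 0 < signedArea (P i) (P j) (P k)) : IsPointed P := by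
  intro j
  have hn := j.pos
  by_cases h1 : n = 1
  · subst h1
    exact ⟨1, one_ne_zero, fun i hi => absurd (Subsingleton.elim i j) hi⟩
  obtain ⟨s, hsj, hs⟩ : ∃ s : Fin n, s ≠ j ∧ ∀ i, i ≠ j → i ≠ s →
      0 < signedArea (P j) (P s) (P i) := by
    by_cases hj : (j : ℕ) + 1 < n
    · refine ⟨⟨j + 1, hj⟩, by simp [Fin.ext_iff], fun i hij his => ?_⟩
      simp only [ne_eq, Fin.ext_iff] at hij his
      rcases lt_or_gt_of_ne hij with hij | hij
      · rw [signedArea_rotate]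
        exact h _ _ _ (Fin.lt_def.2 hij) (Fin.lt_def.2 (by simp))
      · exact h _ _ _ (Fin.lt_def.2 (by simp)) (Fin.lt_def.2 (by simp; omega))
    · refine ⟨⟨0, hn⟩, by simp only [ne_eq, Fin.ext_iff]; omega, fun i hij his => ?_⟩
      simp only [ne_eq, Fin.ext_iff] at hij his
      rw [← signedArea_rotate]
      exact h _ _ _ (Fin.lt_def.2 (by simp; omega)) (Fin.lt_def.2 (by omega))
  by_cases hv : P s - P j = 0
  · refine ⟨1, one_ne_zero, fun i hi k hk => ?_⟩
    have aux (i : Fin n) (hi : i ≠ j) : i = s := by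
      by_contra his
      exact (ne_of_signedArea_ne_zero (hs i hi his).ne').1 (sub_eq_zero.1 hv).symm
    rw [aux i hi, aux k hk]
    simp [Real.pi_pos]
  · have aux (i : Fin n) (hi : i ≠ j) : arg ((P i - P j) / (P s - P j)) ∈ Ico 0 π := by
      by_cases his : i = s
      · subst his
        simp [Real.pi_pos]
      · exact Ioo_subset_Ico_self (arg_mem_Ioo_of_im_pos (im_div_sub_pos (hs i hi his)))
    refine ⟨_, hv, fun i hi k hk => ?_⟩
    have h1 := aux i hi
    have h2 := aux k hk
    simp only [mem_Ico, mem_Ioo] at *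
    constructor <;> linarith

lemma IsPointed.exists_eq_sub {ι : Type*} {P : ι → ℂ} (h : IsPointed P)
    (hinj : Function.Injective P) (j : ι) :
    ∃ T : ι → ℝ, ∀ i, i ≠ j → ∀ k, k ≠ j →
      vertexAngle (P i) (P j) (P k) = T i - T k ∧ T i - T k < π := by
  obtain ⟨v, hv, H⟩ := h j
  refine ⟨fun i => arg ((P i - P j) / v), fun i hi k hk => ⟨?_, (H i hi k hk).2⟩⟩
  have hi' := sub_ne_zero.2 (hinj.ne hi)
  have hk' := sub_ne_zero.2 (hinj.ne hk)
  rw [← arg_div_eq_sub (div_ne_zero hi' hv) (div_ne_zero hk' hv)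
    (Ioo_subset_Ioc_self (H i hi k hk)), div_div_div_cancel_right₀ hv, vertexAngle]

/-- A function on pairs of edges sharing a vertex which is additive at each vertex and sums to zero around
each triangle is the coboundary of a function on unordered pairs. -/
lemma exists_symm_potential {ι : Type*} (c : ι → ι → ι → ℝ)
    (hv : ∀ j i k l, i ≠ j → k ≠ j → l ≠ j → c i j k + c k j l = c i j l)
    (ht : ∀ i j k, i ≠ j → j ≠ k → k ≠ i → c i j k + c j k i + c k i j = 0) :
    ∃ φ : ι → ι → ℝ, (∀ i j, i ≠ j → φ i j = φ j i) ∧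
      ∀ j i k, i ≠ j → k ≠ j → φ i j - φ k j = c i j k := by
  classical
  rcases subsingleton_or_nontrivial ι with hι | hι
  · exact ⟨fun _ _ => 0, fun _ _ _ => rfl, fun j i _ h => absurd (Subsingleton.elim i j) h⟩
  obtain ⟨o, p, hop⟩ := exists_pair_ne ι
  have hz (i j : ι) (hi : i ≠ j) : c i j i = 0 := by linarith [hv j i i i hi hi hi]
  refine ⟨fun i j => if j = o then c i o p else c j o p + c i j o, fun i j hij => ?_,
    fun j i k hi hk => ?_⟩
  · by_cases hi : i = o
    · subst hi
      simp [hij.symm, hz i j hij]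
    · by_cases hj : j = o
      · subst hj
        simp [hij, hz j i hij.symm]
      · simp only [hi, hj, if_false]
        have h1 := ht i j o hij hj (Ne.symm hi)
        have h2 := hv o i j p hi hj hop.symm
        have h3 := hv o j i p hj hi hop.symm
        have h4 := hv i j o j hij.symm (Ne.symm hi) hij.symm
        have h5 := hz j i hij.symm
        linarith
  · by_cases hj : j = o
    · subst hj
      simp only [if_true]
      linarith [hv j i k p hi hk hop.symm]
    · simp only [hj, if_false]
      linarith [hv j i k o hi hk (Ne.symm hj)]

/-- In the direction of angle `θ`, both `P j` and `Q j` are strictly beyond `P i` and `Q i`. -/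
def Separates {ι : Type*} (P Q : ι → ℂ) (θ : ℝ) (i j : ι) : Prop :=
  ∀ x ∈ ({P i, Q i} : Set ℂ), ∀ y ∈ ({P j, Q j} : Set ℂ), 0 < ((y - x) / exp (θ * I)).re

lemma re_div_exp_mul_I (z : ℂ) (θ : ℝ) :
    (z / exp (θ * I)).re = z.re * Real.cos θ + z.im * Real.sin θ := by
  rw [div_eq_mul_inv, ← Complex.exp_neg, ← neg_mul, ← ofReal_neg, mul_re, exp_ofReal_mul_I_re,
    exp_ofReal_mul_I_im, Real.cos_neg, Real.sin_neg]
  ring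

section Separates

variable {ι : Type*} {P Q : ι → ℂ} {θ : ℝ} {i j k l : ι}

lemma separates_iff : Separates P Q θ i j ↔
    max (P i / exp (θ * I)).re (Q i / exp (θ * I)).re <
      min (P j / exp (θ * I)).re (Q j / exp (θ * I)).re := by
  simp only [Separates, mem_insert_iff, mem_singleton_iff, forall_eq_or_imp, forall_eq, sub_div,
    sub_re, sub_pos, lt_min_iff, max_lt_iff]
  tauto

lemma Separates.left (h : Separates P Q θ i j) : 0 < ((P j - P i) / exp (θ * I)).re :=
  h _ (by simp) _ (by simp)

lemma Separates.right (h : Separates P Q θ i j) : 0 < ((Q j - Q i) / exp (θ * I)).re :=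
  h _ (by simp) _ (by simp)

lemma Separates.ne (h : Separates P Q θ i j) : i ≠ j := by
  rintro rfl
  simpa using h.left

lemma Separates.exists_common (h : Separates P Q θ i j) (h' : Separates P Q θ k l) :
    ∃ m, Separates P Q θ m j ∧ Separates P Q θ m l := by
  simp only [separates_iff] at *
  rcases le_total (max (P i / exp (θ * I)).re (Q i / exp (θ * I)).re)
    (max (P k / exp (θ * I)).re (Q k / exp (θ * I)).re) with hik | hik
  · exact ⟨i, h, hik.trans_lt h'⟩
  · exact ⟨k, hik.trans_lt h, h'⟩

lemma Separates.add_pi (h : Separates P Q θ i j) : Separates P Q (θ + π) j i := by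
  intro x hx y hy
  have := h y hy x hx
  rw [re_div_exp_mul_I] at this ⊢
  simp only [Real.cos_add_pi, Real.sin_add_pi, sub_re, sub_im] at *
  linarith

lemma Separates.eventually (h : Separates P Q θ i j) : ∀ᶠ t in 𝓝 θ, Separates P Q t i j := by
  have aux (z : ℂ) (hz : 0 < (z / exp (θ * I)).re) : ∀ᶠ t : ℝ in 𝓝 θ, 0 < (z / exp (t * I)).re := by
    simp only [re_div_exp_mul_I] at *
    exact ContinuousAt.eventually_lt (by fun_prop) (by fun_prop) hz
  simp only [Separates, mem_insert_iff, mem_singleton_iff, forall_eq_or_imp, forall_eq] at h ⊢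
  filter_upwards [aux _ h.1.1, aux _ h.1.2, aux _ h.2.1, aux _ h.2.2] with t h1 h2 h3 h4
  exact ⟨⟨h1, h2⟩, h3, h4⟩

end Separates

lemma vertexAngle_eq_sub {a b c u : ℂ} (h1 : 0 < ((b - a) / u).re) (h2 : 0 < ((b - c) / u).re) :
    vertexAngle a b c = arg ((b - a) / u) - arg ((b - c) / u) := by
  rw [← arg_div_eq_sub_of_re_pos h1 h2, vertexAngle, ← neg_sub b a, ← neg_sub b c, neg_div_neg_eq]

lemma vertexAngle_eq_sub' {a b c u : ℂ} (h1 : 0 < ((a - b) / u).re) (h2 : 0 < ((c - b) / u).re) :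
    vertexAngle a b c = arg ((a - b) / u) - arg ((c - b) / u) :=
  arg_div_eq_sub_of_re_pos h1 h2

theorem exists_direction_forall_not_separates {ι : Type*} {P Q : ι → ℂ}
    (hP : IsPointed P) (hQ : IsPointed Q)
    (hPi : Function.Injective P) (hQi : Function.Injective Q)
    (hPQ : ∀ i j k, i ≠ j → j ≠ k → k ≠ i →
      signedArea (P i) (P j) (P k) * signedArea (Q i) (Q j) (Q k) < 0) :
    ∃ θ, ∀ i j, ¬ Separates P Q θ i j := by
  by_contra! hsep
  have add_vertex {R : ι → ℂ} (hR : IsPointed R) (hRi : Function.Injective R) (j i k l : ι)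
      (hi : i ≠ j) (hk : k ≠ j) (hl : l ≠ j) :
      vertexAngle (R i) (R j) (R k) + vertexAngle (R k) (R j) (R l) =
        vertexAngle (R i) (R j) (R l) := by
    obtain ⟨T, hT⟩ := hR.exists_eq_sub hRi j
    rw [(hT i hi k hk).1, (hT k hk l hl).1, (hT i hi l hl).1]
    ring
  have sum_neg {R : ι → ℂ} (hR : IsPointed R) (hRi : Function.Injective R) (i j k : ι)
      (hij : i ≠ j) (hjk : j ≠ k) (hki : k ≠ i)
      (h : signedArea (R i) (R j) (R k) < 0) :
      vertexAngle (R i) (R j) (R k) + vertexAngle (R j) (R k) (R i) +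
        vertexAngle (R k) (R i) (R j) = -π := by
    have sw (i j k : ι) (hij : i ≠ j) (hjk : j ≠ k) :
        vertexAngle (R k) (R j) (R i) = -vertexAngle (R i) (R j) (R k) := by
      obtain ⟨T, hT⟩ := hR.exists_eq_sub hRi j
      have := hT i hij k hjk.symm
      exact vertexAngle_swap (this.1.trans_lt this.2).ne
    have := vertexAngle_sum_of_pos (a := R k) (b := R j) (c := R i)
      (by rw [signedArea_reverse]; linarith)
    rw [sw i j k hij hjk, sw k i j hki hij, sw j k i hjk hki] at this
    linarith
  obtain ⟨φ, hφs, hφ⟩ := exists_symm_potential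
    (fun i j k => vertexAngle (P i) (P j) (P k) + vertexAngle (Q i) (Q j) (Q k))
    (fun j i k l hi hk hl => by
      linarith [add_vertex hP hPi j i k l hi hk hl, add_vertex hQ hQi j i k l hi hk hl])
    (fun i j k hij hjk hki => by
      rcases mul_neg_iff.1 (hPQ i j k hij hjk hki) with ⟨h1, h2⟩ | ⟨h1, h2⟩
      · linarith [vertexAngle_sum_of_pos h1, sum_neg hQ hQi i j k hij hjk hki h2]
      · linarith [vertexAngle_sum_of_pos h2, sum_neg hP hPi i j k hij hjk hki h1])
  let g (θ : ℝ) (i j : ι) : ℝ :=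
    φ i j - arg ((P j - P i) / exp (θ * I)) - arg ((Q j - Q i) / exp (θ * I))
  have g_left {θ : ℝ} {i j k : ι} (h : Separates P Q θ i j) (h' : Separates P Q θ k j) :
      g θ i j = g θ k j := by
    have := hφ j i k h.ne h'.ne
    simp only [vertexAngle_eq_sub h.left h'.left, vertexAngle_eq_sub h.right h'.right] at this
    simp only [g]
    linarith
  have g_right {θ : ℝ} {i j k : ι} (h : Separates P Q θ i j) (h' : Separates P Q θ i k) :
      g θ i j = g θ i k := by
    have := hφ i j k h.ne.symm h'.ne.symm
    simp only [vertexAngle_eq_sub' h.left h'.left, vertexAngle_eq_sub' h.right h'.right] at this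
    simp only [g]
    linarith [hφs i j h.ne, hφs i k h'.ne]
  have g_eq {θ : ℝ} {i j k l : ι} (h : Separates P Q θ i j) (h' : Separates P Q θ k l) :
      g θ i j = g θ k l := by
    obtain ⟨m, hm, hm'⟩ := h.exists_common h'
    rw [g_left h hm, g_right hm hm', g_left hm' h']
  choose a b hab using hsep
  have hloc : IsLocallyConstant fun θ => g θ (a θ) (b θ) - 2 * θ := by
    refine (IsLocallyConstant.iff_eventually_eq _).2 fun θ => ?_
    filter_upwards [(hab θ).eventually, Metric.ball_mem_nhds θ Real.pi_div_two_pos] with t ht htb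
    rw [Metric.mem_ball, Real.dist_eq] at htb
    simp only [g_eq (hab t) ht]
    simp only [g, arg_div_exp_eq_sub (hab θ).left htb, arg_div_exp_eq_sub (hab θ).right htb]
    ring
  have hconst := hloc.apply_eq_of_preconnectedSpace 0 (0 + π)
  simp only [g_eq (hab (0 + π)) (hab 0).add_pi] at hconst
  have hrot (x y : ℂ) : (x - y) / exp ((0 + π : ℝ) * I) = (y - x) / exp ((0 : ℝ) * I) := by
    simp [div_neg]
  simp only [g, hrot, hφs _ _ (hab 0).ne] at hconst
  linarith [Real.pi_pos]

/-- The point of the complex plane with the given coordinates. -/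
def toComplex (x : Fin 2 → ℝ) : ℂ := ⟨x 0, x 1⟩

lemma liftDet_eq_signedArea (x y z : Fin 2 → ℝ) :
    liftDet ![x, y, z] = signedArea (toComplex x) (toComplex y) (toComplex z) := by
  have h0 (f : Fin 2 → ℝ) : (Fin.lastCases (1 : ℝ) f (0 : Fin 3) : ℝ) = f 0 := rfl
  have h1 (f : Fin 2 → ℝ) : (Fin.lastCases (1 : ℝ) f (1 : Fin 3) : ℝ) = f 1 := rfl
  have h2 (f : Fin 2 → ℝ) : (Fin.lastCases (1 : ℝ) f (2 : Fin 3) : ℝ) = 1 := rfl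
  rw [liftDet, Matrix.det_fin_three]
  simp [h0, h1, h2, signedArea, toComplex]
  ring

lemma injective_of_signedArea_ne_zero {n : ℕ} (hn : 3 ≤ n) {P : Fin n → ℂ}
    (h : ∀ i j k, i ≠ j → j ≠ k → k ≠ i → signedArea (P i) (P j) (P k) ≠ 0) :
    Function.Injective P := by
  intro i j hij
  by_contra hne
  obtain ⟨k, hk⟩ : ∃ k, k ∉ ({i, j} : Finset (Fin n)) := by
    by_contra! hall
    have h1 : Fintype.card (Fin n) ≤ _ := Finset.card_le_card (fun k _ => hall k)
    have h2 := Finset.card_le_two (a := i) (b := j)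
    rw [Fintype.card_fin] at h1
    omega
  simp only [Finset.mem_insert, Finset.mem_singleton, not_or] at hk
  exact (ne_of_signedArea_ne_zero (h i j k hne (Ne.symm hk.2) hk.1)).1 hij

/-- Two opposite orientations of increasing triples are opposite on all triples. -/
lemma signedArea_mul_neg {n : ℕ} {P Q : Fin n → ℂ}
    (hP : ∀ i j k, i < j → j < k → 0 < signedArea (P i) (P j) (P k))
    (hQ : ∀ i j k, i < j → j < k → signedArea (Q i) (Q j) (Q k) < 0) (i j k : Fin n)
    (hij : i ≠ j) (hjk : j ≠ k) (hki : k ≠ i) :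
    signedArea (P i) (P j) (P k) * signedArea (Q i) (Q j) (Q k) < 0 := by
  have base (i j k : Fin n) (hij : i < j) (hjk : j < k) :=
    mul_neg_of_pos_of_neg (hP i j k hij hjk) (hQ i j k hij hjk)
  have rot (i j k : Fin n)
      (h : signedArea (P i) (P j) (P k) * signedArea (Q i) (Q j) (Q k) < 0) :
      signedArea (P j) (P k) (P i) * signedArea (Q j) (Q k) (Q i) < 0 := by
    rwa [signedArea_rotate (P i), signedArea_rotate (Q i)]
  have swap (i j k : Fin n)
      (h : signedArea (P i) (P j) (P k) * signedArea (Q i) (Q j) (Q k) < 0) :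
      signedArea (P i) (P k) (P j) * signedArea (Q i) (Q k) (Q j) < 0 := by
    rwa [signedArea_swap (P i) (P j), signedArea_swap (Q i) (Q j), neg_mul_neg]
  rcases lt_or_gt_of_ne hij with h1 | h1 <;> rcases lt_or_gt_of_ne hjk with h2 | h2 <;>
    rcases lt_or_gt_of_ne hki with h3 | h3
  · exact absurd (h1.trans (h2.trans h3)) (lt_irrefl _)
  · exact base _ _ _ h1 h2
  · exact rot _ _ _ (base _ _ _ h3 h1)
  · exact swap _ _ _ (base _ _ _ h3 h2)
  · exact rot _ _ _ (rot _ _ _ (base _ _ _ h2 h3))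
  · exact rot _ _ _ (rot _ _ _ (swap _ _ _ (base _ _ _ h1 h3)))
  · exact rot _ _ _ (swap _ _ _ (base _ _ _ h2 h1))
  · exact absurd (h1.trans (h3.trans h2)) (lt_irrefl _)

lemma exists_mem_segment_of_mem_uIcc {E : Type*} [AddCommGroup E] [Module ℝ E] (f : E →ₗ[ℝ] ℝ)
    {x y : E} {c : ℝ} (h : c ∈ uIcc (f x) (f y)) : ∃ z ∈ segment ℝ x y, f z = c := by
  rw [← segment_eq_uIcc] at h
  obtain ⟨a, b, ha, hb, hab, rfl⟩ := h
  exact ⟨a • x + b • y, ⟨a, b, ha, hb, hab, rfl⟩, by simp⟩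

/-- **Cutting convex polygons (Holmsen–Szabó–Tóth).** If `A 1, …, A n` are the vertices of
a convex polygon listed counterclockwise and `B 1, …, B n` those of a convex polygon listed
clockwise, then some line meets every segment `[A j, B j]`. -/
theorem cutting_convex_polygons {n : ℕ} (hn : 3 ≤ n) (A B : Fin n → (Fin 2 → ℝ))
    (hA : ∀ i j k : Fin n, i < j → j < k → 0 < liftDet ![A i, A j, A k])
    (hB : ∀ i j k : Fin n, i < j → j < k → liftDet ![B i, B j, B k] < 0) :
    ∃ H : Set (Fin 2 → ℝ), IsAffHyperplane H ∧
      ∀ j, (segment ℝ (A j) (B j) ∩ H).Nonempty := by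
  simp only [liftDet_eq_signedArea] at hA hB
  let P : Fin n → ℂ := fun i => toComplex (A i)
  let Q : Fin n → ℂ := fun i => toComplex (B i)
  have hPQ := signedArea_mul_neg (P := P) (Q := Q) hA hB
  have hP : IsPointed P := isPointed_of_signedArea_pos hA
  have hQ : IsPointed Q := by
    refine IsPointed.comp_equiv (e := Fin.revPerm)
      (isPointed_of_signedArea_pos fun i j k hij hjk => ?_)
    have := hB k.rev j.rev i.rev (Fin.rev_lt_rev.2 hjk) (Fin.rev_lt_rev.2 hij)
    rw [signedArea_reverse] at this
    exact neg_lt_zero.1 this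
  obtain ⟨θ, hθ⟩ := exists_direction_forall_not_separates hP hQ
    (injective_of_signedArea_ne_zero hn fun i j k h1 h2 h3 =>
      left_ne_zero_of_mul (hPQ i j k h1 h2 h3).ne)
    (injective_of_signedArea_ne_zero hn fun i j k h1 h2 h3 =>
      right_ne_zero_of_mul (hPQ i j k h1 h2 h3).ne) hPQ
  let u : Fin 2 → ℝ := ![Real.cos θ, Real.sin θ]
  let f : (Fin 2 → ℝ) →ₗ[ℝ] ℝ := dotProductBilin ℝ ℝ u
  have hf (x : Fin 2 → ℝ) : f x = ∑ j, u j * x j := rfl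
  have hfre (x : Fin 2 → ℝ) : (toComplex x / exp (θ * I)).re = f x := by
    rw [re_div_exp_mul_I, hf, Fin.sum_univ_two]
    simp [u, toComplex, mul_comm]
  have : Nonempty (Fin n) := ⟨⟨0, by omega⟩⟩
  obtain ⟨m, hm⟩ := Finite.exists_min fun i => max (f (A i)) (f (B i))
  refine ⟨{x | ∑ j, u j * x j = max (f (A m)) (f (B m))}, ⟨u, _, fun hu => ?_, rfl⟩, fun j => ?_⟩
  · have h0 : Real.cos θ = 0 := congrFun hu 0
    have h1 : Real.sin θ = 0 := congrFun hu 1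
    simpa [h0, h1] using Real.sin_sq_add_cos_sq θ
  · have h := hθ m j
    simp only [separates_iff, P, Q, hfre, not_lt] at h
    exact exists_mem_segment_of_mem_uIcc f ⟨h, hm j⟩
end

section
/- Let $C \colon [0,1] \to \mathbb{R}^d$ be a convex curve. Then the sign of the determinant of the $(d+1)\times(d+1)$ matrix with columns $(C(t_0),1), (C(t_1),1), \dots, (C(t_d),1)$ is the same for all choices $0 \le t_0 < t_1 < \dots < t_d \le 1$. -/
open Set

/-- The augmented matrix of points of a convex curve at distinct parameters is nonsingular. -/
theorem IsConvexCurve.liftDet_ne_zero {d : ℕ} {C : ℝ → (Fin d → ℝ)} (hC : IsConvexCurve C)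
    {t : Fin (d + 1) → ℝ} (ht : Function.Injective t) (ht' : ∀ i, t i ∈ Icc (0 : ℝ) 1) :
    liftDet (fun i => C (t i)) ≠ 0 := by
  intro h0
  obtain ⟨v, hv, hvM⟩ := Matrix.exists_vecMul_eq_zero_iff.mpr h0
  have key : ∀ i, ∑ j : Fin d, v j.castSucc * C (t i) j + v (Fin.last d) = 0 := by
    intro i
    simpa [Matrix.vecMul, dotProduct, Fin.sum_univ_castSucc] using congrFun hvM i
  have hu : (fun j : Fin d => v j.castSucc) ≠ 0 := by
    intro hu
    have hu' : ∀ j : Fin d, v j.castSucc = 0 := fun j => congrFun hu j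
    have hlast : v (Fin.last d) = 0 := by simpa [hu'] using key 0
    exact hv (funext fun j => Fin.lastCases hlast hu' j)
  have hcard := hC.2 _ ⟨_, -v (Fin.last d), hu, rfl⟩
  have hsub : range t ⊆ {s ∈ Icc (0 : ℝ) 1 |
      C s ∈ {x : Fin d → ℝ | ∑ j, v j.castSucc * x j = -v (Fin.last d)}} := by
    rintro _ ⟨i, rfl⟩
    exact ⟨ht' i, eq_neg_of_add_eq_zero_left (key i)⟩
  have hrange : (range t).encard = ((d + 1 : ℕ) : ℕ∞) := by
    rw [← image_univ, ht.encard_image, encard_univ, ENat.card_eq_coe_fintype_card,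
      Fintype.card_fin]
  have hle := (encard_le_encard hsub).trans hcard
  rw [hrange, Nat.cast_le] at hle
  omega

theorem continuous_liftDet {d : ℕ} : Continuous (liftDet (d := d)) := by
  refine Continuous.matrix_det (continuous_matrix fun j i => ?_)
  induction j using Fin.lastCases with
  | last => simpa using continuous_const
  | cast j => simpa using continuous_apply_apply i j

theorem convex_setOf_strictMono_mem {d : ℕ} {I : Set ℝ} (hI : Convex ℝ I) :
    Convex ℝ {t : Fin (d + 1) → ℝ | StrictMono t ∧ ∀ i, t i ∈ I} := by
  rintro x ⟨hx, hx'⟩ y ⟨hy, hy'⟩ a b ha hb hab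
  refine ⟨fun i j hij => ?_, fun i => hI (hx' i) (hy' i) ha hb hab⟩
  simp only [Pi.add_apply, Pi.smul_apply, smul_eq_mul]
  have hxij := hx hij
  have hyij := hy hij
  rcases ha.eq_or_lt with rfl | ha
  · obtain rfl : b = 1 := by linarith
    linarith
  · exact add_lt_add_of_lt_of_le (mul_lt_mul_of_pos_left hxij ha)
      (mul_le_mul_of_nonneg_left hyij.le hb)

/-- A continuous nonvanishing real function on a preconnected set has constant sign. -/
theorem IsPreconnected.real_sign_eq {X : Type*} [TopologicalSpace X] {K : Set X}
    (hK : IsPreconnected K) {f : X → ℝ} (hf : ContinuousOn f K) (h0 : ∀ x ∈ K, f x ≠ 0)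
    {x y : X} (hx : x ∈ K) (hy : y ∈ K) : Real.sign (f x) = Real.sign (f y) := by
  have hord := (hK.image f hf).ordConnected
  have hzero : (0 : ℝ) ∉ f '' K := fun ⟨z, hz, hz0⟩ => h0 z hz hz0
  have hfx := mem_image_of_mem f hx
  have hfy := mem_image_of_mem f hy
  rcases (h0 x hx).lt_or_gt with h | h <;> rcases (h0 y hy).lt_or_gt with h' | h'
  · rw [Real.sign_of_neg h, Real.sign_of_neg h']
  · exact absurd (hord.out hfx hfy ⟨h.le, h'.le⟩) hzero
  · exact absurd (hord.out hfy hfx ⟨h'.le, h.le⟩) hzero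
  · rw [Real.sign_of_pos h, Real.sign_of_pos h']

/-- For a convex curve `C` in ℝ^d, the sign of the determinant of the matrix with columns
`(C t₀, 1), …, (C t_d, 1)` is the same for all choices `0 ≤ t₀ < t₁ < ⋯ < t_d ≤ 1`. -/
theorem convexCurve_liftDet_sign_const {d : ℕ} (C : ℝ → (Fin d → ℝ))
    (hC : IsConvexCurve C) (s t : Fin (d + 1) → ℝ)
    (hs : StrictMono s) (hs' : ∀ i, s i ∈ Icc (0 : ℝ) 1)
    (ht : StrictMono t) (ht' : ∀ i, t i ∈ Icc (0 : ℝ) 1) :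
    Real.sign (liftDet (fun i => C (s i))) = Real.sign (liftDet (fun i => C (t i))) := by
  have hcont : ContinuousOn (fun r : Fin (d + 1) → ℝ => liftDet (fun i => C (r i)))
      {r | StrictMono r ∧ ∀ i, r i ∈ Icc (0 : ℝ) 1} :=
    continuous_liftDet.comp_continuousOn <| continuousOn_pi.mpr fun i =>
      hC.1.comp (continuous_apply i).continuousOn fun _ hr => hr.2 i
  exact (convex_setOf_strictMono_mem (convex_Icc 0 1)).isPreconnected.real_sign_eq hcont
    (fun _ hr => hC.liftDet_ne_zero hr.1.injective hr.2) ⟨hs, hs'⟩ ⟨ht, ht'⟩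
end

section
/- Let $C \colon [0,1] \to \mathbb{R}^d$ be a convex curve with $d \ge 1$. Then $C$ is injective. -/
open Set

/-- Any point together with fewer than `d` further points of ℝ^d lies on an affine hyperplane. -/
theorem exists_isAffHyperplane_of_card_lt {d : ℕ} {ι : Type*} [Fintype ι]
    (hι : Fintype.card ι < d) (p : Fin d → ℝ) (q : ι → Fin d → ℝ) :
    ∃ H : Set (Fin d → ℝ), IsAffHyperplane H ∧ p ∈ H ∧ ∀ i, q i ∈ H := by
  have hker := LinearMap.ker_ne_bot_of_finrank_lt
    (f := (Matrix.of fun i j => q i j - p j).mulVecLin) (by simpa using hι)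
  obtain ⟨u, hu, hu0⟩ := Submodule.exists_mem_ne_zero_of_ne_bot hker
  refine ⟨_, ⟨u, ∑ j, u j * p j, hu0, rfl⟩, rfl, fun i => ?_⟩
  have h : ∑ j, (q i j - p j) * u j = 0 := congrFun (LinearMap.mem_ker.1 hu) i
  simp only [sub_mul, Finset.sum_sub_distrib, sub_eq_zero] at h
  simpa only [mem_ofPred_eq, mul_comm] using h

/-- A convex curve in ℝ^d with d ≥ 1 is injective (on its domain [0,1]). -/
theorem convexCurve_injective {d : ℕ} (hd : 1 ≤ d) (C : ℝ → (Fin d → ℝ))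
    (hC : IsConvexCurve C) : Set.InjOn C (Icc 0 1) := by
  intro s hs t ht hst
  by_contra hne
  have hinf : (Icc (0 : ℝ) 1 \ {s, t}).Infinite :=
    (Icc_infinite zero_lt_one).sdiff (toFinite _)
  obtain ⟨S, hS, hcard⟩ := hinf.exists_subset_card_eq (d - 1)
  obtain ⟨H, hH, hsH, hSH⟩ := exists_isAffHyperplane_of_card_lt (ι := S)
    (by rw [Fintype.card_coe]; omega) (C s) (fun r => C r)
  have htS : t ∉ S := fun h => (hS h).2 (by simp)
  have hsS : s ∉ insert t S := by
    rw [Finset.mem_insert, not_or]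
    exact ⟨hne, fun h => (hS h).2 (by simp)⟩
  have hsub : ((insert s (insert t S) : Finset ℝ) : Set ℝ) ⊆
      {r ∈ Icc (0 : ℝ) 1 | C r ∈ H} := by
    intro r hr
    simp only [Finset.coe_insert, mem_insert_iff, Finset.mem_coe] at hr
    rcases hr with rfl | rfl | hr
    · exact ⟨hs, hsH⟩
    · exact ⟨ht, hst ▸ hsH⟩
    · exact ⟨(hS hr).1, hSH ⟨r, hr⟩⟩
  have hle := (encard_le_encard hsub).trans (hC.2 H hH)
  rw [encard_coe_eq_coe_finsetCard, Nat.cast_le, Finset.card_insert_of_notMem hsS,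
    Finset.card_insert_of_notMem htS] at hle
  omega
end

section
/- Let $A \subseteq \mathbb{R}^d$ be a set and $\gamma \colon A \to \mathbb{R}^d$ a function such that $A$ is contained in some fixed compact set and such that for every finite subset $S \subseteq A$ there exists an affine hyperplane $H_S$ intersecting every closed segment $[a, \gamma(a)]$ with $a \in S$. Then there exists a single affine hyperplane $H$ intersecting every closed segment $[a, \gamma(a)]$ with $a \in A$. -/
open Set

/-- A hyperplane `⟨u, x⟩ = c` meets the segment `[a, b]` iff `a` and `b` do not lie strictly on
the same side of it. -/
theorem segment_inter_hyperplane_nonempty_iff {d : ℕ} (u a b : Fin d → ℝ) (c : ℝ) :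
    (segment ℝ a b ∩ {x | ∑ j, u j * x j = c}).Nonempty ↔
      (u ⬝ᵥ a - c) * (u ⬝ᵥ b - c) ≤ 0 := by
  have himage : dotProductBilin ℝ ℝ u '' segment ℝ a b = uIcc (u ⬝ᵥ a) (u ⬝ᵥ b) := by
    rw [← segment_eq_uIcc]
    exact image_segment ℝ (dotProductBilin ℝ ℝ u).toAffineMap a b
  have hmem : (segment ℝ a b ∩ {x | ∑ j, u j * x j = c}).Nonempty ↔
      c ∈ uIcc (u ⬝ᵥ a) (u ⬝ᵥ b) := by
    rw [← himage]
    rfl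
  rw [hmem, mem_uIcc, mul_nonpos_iff]
  simp only [sub_nonneg, sub_nonpos]
  tauto

/-- **Compactness step.** If `A` is contained in a compact set and every finite subset
`S ⊆ A` admits an affine hyperplane meeting all segments `[a, γ a]` with `a ∈ S`, then a
single affine hyperplane meets all segments `[a, γ a]` with `a ∈ A`. -/
theorem hyperplane_of_finite_hyperplanes {d : ℕ} (A : Set (Fin d → ℝ))
    (γ : (Fin d → ℝ) → (Fin d → ℝ)) (K : Set (Fin d → ℝ))
    (hK : IsCompact K) (hAK : A ⊆ K)
    (hfin : ∀ S : Finset (Fin d → ℝ), ↑S ⊆ A →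
      ∃ H : Set (Fin d → ℝ), IsAffHyperplane H ∧
        ∀ a ∈ S, (segment ℝ a (γ a) ∩ H).Nonempty) :
    ∃ H : Set (Fin d → ℝ), IsAffHyperplane H ∧
      ∀ a ∈ A, (segment ℝ a (γ a) ∩ H).Nonempty := by
  rcases A.eq_empty_or_nonempty with rfl | ⟨a₀, ha₀⟩
  · obtain ⟨H, hH, -⟩ := hfin ∅ (by simp)
    exact ⟨H, hH, by simp⟩
  -- Hyperplanes are parametrized, up to scaling, by the unit sphere of pairs `(u, c)`.
  let F : A → Set ((Fin d → ℝ) × ℝ) := fun a ↦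
    {p | (p.1 ⬝ᵥ (a : Fin d → ℝ) - p.2) * (p.1 ⬝ᵥ γ a - p.2) ≤ 0}
  have hclosed (a : A) : IsClosed (F a) :=
    isClosed_le (by fun_prop) continuous_const
  have hinter (S : Finset A) :
      (Metric.sphere (0 : (Fin d → ℝ) × ℝ) 1 ∩ ⋂ a ∈ S, F a).Nonempty := by
    obtain ⟨_, ⟨u, c, hu, rfl⟩, hS⟩ := hfin (S.map (Function.Embedding.subtype _)) (by simp)
    have hp : (u, c) ≠ 0 := fun h ↦ hu (congrArg Prod.fst h)
    refine ⟨‖(u, c)‖⁻¹ • (u, c), ?_, mem_iInter₂.2 fun a ha ↦ ?_⟩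
    · rw [mem_sphere_zero_iff_norm, norm_smul, norm_inv, norm_norm,
        inv_mul_cancel₀ (norm_ne_zero_iff.2 hp)]
    · have h := (segment_inter_hyperplane_nonempty_iff u a (γ a) c).1
        (hS a (Finset.mem_map_of_mem _ ha))
      change (_ • u ⬝ᵥ _ - _ • c) * (_ • u ⬝ᵥ _ - _ • c) ≤ 0
      simp only [smul_dotProduct, ← smul_sub, smul_mul_smul_comm]
      exact mul_nonpos_of_nonneg_of_nonpos (mul_self_nonneg _) h
  obtain ⟨⟨u, c⟩, hp, hF⟩ :=
    (isCompact_sphere (0 : (Fin d → ℝ) × ℝ) 1).inter_iInter_nonempty F hclosed hinter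
  have hF' (a) (ha : a ∈ A) : (u ⬝ᵥ a - c) * (u ⬝ᵥ γ a - c) ≤ 0 := mem_iInter.1 hF ⟨a, ha⟩
  refine ⟨{x | ∑ j, u j * x j = c}, ⟨u, c, ?_, rfl⟩, fun a ha ↦
    (segment_inter_hyperplane_nonempty_iff u a (γ a) c).2 (hF' a ha)⟩
  rintro rfl
  have hc : c * c ≤ 0 := by simpa using hF' a₀ ha₀
  have hc0 : c = 0 := mul_self_eq_zero.1 (hc.antisymm (mul_self_nonneg c))
  subst hc0
  simp at hp
end
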